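/- Let I = (f_k,...,f_n) ⊂ S = K[x_0,...,x_n] be a proper homogeneous ideal with dim Proj(S/I) = k (a quasi-complete intersection). Then there exist homogeneous polynomials f'_{k+1},...,f'_n with deg f'_i = deg f_i, I = (f_k, f'_{k+1},...,f'_n), and such that f'_{k+1},...,f'_n is a regular sequence in S. -/

import Mathlib

set_option synthInstance.maxHeartbeats 1000000
set_option maxHeartbeats 1000000

section LocalRing

open IsLocalRing

/-- Multiplication by `x` is injective on `R ⧸ J`. -/
def Ideal.RegularMod {R : Type*} [CommRing R] (J : Ideal R) (x : R) : Prop :=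
  ∀ a, x * a ∈ J → a ∈ J

/-- The local ring quotient `R ⧸ J` admits a regular sequence of length `r` in its
maximal ideal. -/
def Ideal.DepthGE {R : Type*} [CommRing R] [IsLocalRing R] : ℕ → Ideal R → Prop
  | 0, J => J ≤ maximalIdeal R
  | r + 1, J => ∃ x ∈ maximalIdeal R, J.RegularMod x ∧ Ideal.DepthGE r (J ⊔ Ideal.span {x})

namespace Ideal

section Local

variable {R : Type*} [CommRing R]

lemma mem_sup_span_singleton_iff {J : Ideal R} {x a : R} :
    a ∈ J ⊔ span {x} ↔ ∃ b, a - x * b ∈ J := by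
  rw [Submodule.mem_sup]
  constructor
  · rintro ⟨y, hy, z, hz, rfl⟩
    obtain ⟨b, rfl⟩ := mem_span_singleton'.mp hz
    exact ⟨b, by convert hy using 1; ring⟩
  · rintro ⟨b, hb⟩
    exact ⟨_, hb, x * b, mul_mem_right _ _ (mem_span_singleton_self x), by ring⟩

lemma mem_associatedPrimes_quotient_iff [IsNoetherianRing R] {J P : Ideal R} :
    P ∈ associatedPrimes R (R ⧸ J) ↔ P.IsPrime ∧ ∃ u, ∀ a, a ∈ P ↔ a * u ∈ J := by
  rw [AssociatedPrimes.mem_iff, isAssociatedPrime_iff]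
  refine and_congr_right fun _ ↦ ⟨?_, ?_⟩
  · rintro ⟨x, rfl⟩
    obtain ⟨u, rfl⟩ := Quotient.mk_surjective x
    refine ⟨u, fun a ↦ ?_⟩
    rw [Submodule.mem_colon_singleton, Submodule.mem_bot, Algebra.smul_def,
      Quotient.algebraMap_eq, ← map_mul, Quotient.eq_zero_iff_mem]
  · rintro ⟨u, hu⟩
    refine ⟨Quotient.mk J u, ?_⟩
    ext a
    rw [Submodule.mem_colon_singleton, Submodule.mem_bot, Algebra.smul_def,
      Quotient.algebraMap_eq, ← map_mul, Quotient.eq_zero_iff_mem, hu]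

lemma regularMod_of_forall_notMem_associatedPrimes [IsNoetherianRing R] {J : Ideal R} {x : R}
    (h : ∀ P ∈ associatedPrimes R (R ⧸ J), x ∉ P) : J.RegularMod x := by
  intro a ha
  by_contra haJ
  obtain ⟨P, hP, hle⟩ := exists_le_isAssociatedPrime_of_isNoetherianRing R
    (Quotient.mk J a) (by rwa [Ne, Quotient.eq_zero_iff_mem])
  refine h P hP (hle ?_)
  rwa [Submodule.mem_colon_singleton, Submodule.mem_bot, Algebra.smul_def,
    Quotient.algebraMap_eq, ← map_mul, Quotient.eq_zero_iff_mem]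

lemma notMem_of_regularMod [IsNoetherianRing R] {J P : Ideal R} {x : R} (hx : J.RegularMod x)
    (hP : P ∈ associatedPrimes R (R ⧸ J)) : x ∉ P := by
  obtain ⟨hp, u, hu⟩ := mem_associatedPrimes_quotient_iff.mp hP
  intro hxP
  exact hp.ne_top ((eq_top_iff_one _).mpr ((hu 1).mpr (by simpa using hx u ((hu x).mp hxP))))

/-- Prime avoidance for the zero divisors of finitely many quotients. -/
lemma exists_mem_forall_regularMod [IsNoetherianRing R] (m : Ideal R) (s : Finset (Ideal R))
    (h : ∀ J ∈ s, ∃ x ∈ m, J.RegularMod x) : ∃ z ∈ m, ∀ J ∈ s, J.RegularMod z := by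
  by_contra! hc
  have hfin : (⋃ J ∈ s, associatedPrimes R (R ⧸ J)).Finite :=
    s.finite_toSet.biUnion fun J _ ↦ associatedPrimes.finite R (R ⧸ J)
  obtain ⟨P, hP, hle⟩ := (m.subset_union_prime_finite hfin (f := id) 0 0
    (by simp only [Set.mem_iUnion]; rintro P ⟨J, -, hP⟩ - -; exact hP.isPrime)).mp (by
      intro z hz
      obtain ⟨J, hJ, hzJ⟩ := hc z hz
      by_contra hz'
      refine hzJ (regularMod_of_forall_notMem_associatedPrimes fun P hP hzP ↦ hz' ?_)
      exact Set.mem_biUnion (Set.mem_biUnion hJ hP) hzP)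
  simp only [Set.mem_iUnion] at hP
  obtain ⟨J, hJ, hP⟩ := hP
  obtain ⟨x, hx, hreg⟩ := h J hJ
  exact notMem_of_regularMod hreg hP (hle hx)

lemma RegularMod.sup_span_singleton_comm {J : Ideal R} {y z : R}
    (hy : J.RegularMod y) (hyz : (J ⊔ span {y}).RegularMod z) :
    (J ⊔ span {z}).RegularMod y := by
  intro a ha
  obtain ⟨b, hb⟩ := mem_sup_span_singleton_iff.mp ha
  have h1 : z * b ∈ J ⊔ span {y} := mem_sup_span_singleton_iff.mpr
    ⟨a, by convert J.neg_mem hb using 1; ring⟩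
  obtain ⟨c, hc⟩ := mem_sup_span_singleton_iff.mp (hyz _ h1)
  refine mem_sup_span_singleton_iff.mpr ⟨c, hy _ ?_⟩
  convert J.add_mem hb (J.mul_mem_left z hc) using 1
  ring

variable [IsLocalRing R]

lemma exists_forall_mul_mem_of_forall_not_regularMod [IsNoetherianRing R] {J : Ideal R}
    (h : ∀ w ∈ maximalIdeal R, ¬ J.RegularMod w) :
    ∃ u ∉ J, ∀ w ∈ maximalIdeal R, w * u ∈ J := by
  obtain ⟨P, hP, hle⟩ := ((maximalIdeal R).subset_union_prime_finite
    (associatedPrimes.finite R (R ⧸ J)) (f := id) 0 0 fun P hP _ _ ↦ hP.isPrime).mp (by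
      intro z hz
      by_contra hz'
      exact h z hz (regularMod_of_forall_notMem_associatedPrimes fun P hP hzP ↦
        hz' (Set.mem_biUnion hP hzP)))
  obtain ⟨hp, u, hu⟩ := mem_associatedPrimes_quotient_iff.mp hP
  refine ⟨u, fun huJ ↦ ?_, fun w hw ↦ (hu w).mp (hle hw)⟩
  exact hp.ne_top ((eq_top_iff_one _).mpr ((hu 1).mpr (by simpa using huJ)))

lemma exists_regularMod_sup_span [IsNoetherianRing R] {J : Ideal R} {x y : R}
    (hx : J.RegularMod x) (hym : y ∈ maximalIdeal R) (hy : J.RegularMod y)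
    (h : ∃ w ∈ maximalIdeal R, (J ⊔ span {y}).RegularMod w) :
    ∃ w ∈ maximalIdeal R, (J ⊔ span {x}).RegularMod w := by
  by_contra! hc
  obtain ⟨u, hu, hmu⟩ := exists_forall_mul_mem_of_forall_not_regularMod hc
  obtain ⟨w, hw, hreg⟩ := h
  obtain ⟨u', hu'⟩ := mem_sup_span_singleton_iff.mp (hmu y hym)
  obtain ⟨v, hv⟩ := mem_sup_span_singleton_iff.mp (hmu w hw)
  have h1 : w * u' ∈ J ⊔ span {y} := by
    refine mem_sup_span_singleton_iff.mpr ⟨v, hx _ ?_⟩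
    convert J.sub_mem (J.mul_mem_left y hv) (J.mul_mem_left w hu') using 1
    ring
  obtain ⟨u'', hu''⟩ := mem_sup_span_singleton_iff.mp (hreg _ h1)
  refine hu (mem_sup_span_singleton_iff.mpr ⟨u'', hy _ ?_⟩)
  convert J.add_mem hu' (J.mul_mem_left x hu'') using 1
  ring

lemma DepthGE.sup_span_singleton [IsNoetherianRing R] {r : ℕ} {J : Ideal R} {x : R}
    (h : DepthGE (r + 1) J) (hxm : x ∈ maximalIdeal R) (hx : J.RegularMod x) :
    DepthGE r (J ⊔ span {x}) := by
  classical
  induction r generalizing J x with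
  | zero =>
    obtain ⟨y, hy, hreg, hd⟩ := h
    exact sup_le (le_sup_left.trans hd) ((span_singleton_le_iff_mem _).mpr hxm)
  | succ r ih =>
    obtain ⟨y, hym, hy, hd⟩ := h
    obtain ⟨w, hwm, hw, -⟩ := id hd
    obtain ⟨z, hzm, hz⟩ := exists_mem_forall_regularMod (maximalIdeal R)
      {J ⊔ span {y}, J ⊔ span {x}} (by
        simp only [Finset.mem_insert, Finset.mem_singleton, forall_eq_or_imp, forall_eq]
        exact ⟨⟨w, hwm, hw⟩, exists_regularMod_sup_span hx hym hy ⟨w, hwm, hw⟩⟩)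
    simp only [Finset.mem_insert, Finset.mem_singleton, forall_eq_or_imp, forall_eq] at hz
    obtain ⟨hzy, hzx⟩ := hz
    refine ⟨z, hzm, hzx, ?_⟩
    rw [sup_right_comm]
    refine ih ⟨y, hym, hy.sup_span_singleton_comm hzy, ?_⟩ hxm (hx.sup_span_singleton_comm hzx)
    rw [sup_right_comm]
    exact ih hd hzm hzy

lemma exists_associatedPrimes_sup_span [IsNoetherianRing R] {J P : Ideal R} {x : R}
    (hxm : x ∈ maximalIdeal R) (hx : J.RegularMod x)
    (hP : P ∈ associatedPrimes R (R ⧸ J)) :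
    ∃ Q ∈ associatedPrimes R (R ⧸ (J ⊔ span {x})), P ≤ Q ∧ x ∈ Q := by
  obtain ⟨hp, u, hu⟩ := mem_associatedPrimes_quotient_iff.mp hP
  let N : Ideal R := J.colon (P : Set R)
  have hN : ∀ b, b ∈ N ↔ ∀ p ∈ P, p * b ∈ J := by
    intro b
    simp [N, Submodule.mem_colon, mul_comm]
  have huJ : u ∉ J := fun h ↦
    hp.ne_top ((eq_top_iff_one _).mpr ((hu 1).mpr (by simpa using h)))
  obtain ⟨v, hv, hvx⟩ : ∃ v ∈ N, v ∉ J ⊔ span {x} := by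
    by_contra! hc
    suffices hNJ : N ≤ J from huJ (hNJ ((hN u).mpr fun p hpP ↦ (hu p).mp hpP))
    refine Submodule.le_of_le_smul_of_le_jacobson_bot (I := span {x}) (IsNoetherian.noetherian N)
      ((span_singleton_le_iff_mem _).mpr ?_) ?_
    · rwa [IsLocalRing.jacobson_eq_maximalIdeal ⊥ bot_ne_top]
    · intro b hb
      obtain ⟨c, hc'⟩ := mem_sup_span_singleton_iff.mp (hc b hb)
      refine Submodule.mem_sup.mpr ⟨_, hc', x * c, ?_, by ring⟩
      refine mul_mem_mul (mem_span_singleton_self x) ((hN c).mpr fun p hpP ↦ hx _ ?_)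
      convert J.sub_mem ((hN b).mp hb p hpP) (J.mul_mem_left p hc') using 1
      ring
  obtain ⟨Q, hQ, hle⟩ := exists_le_isAssociatedPrime_of_isNoetherianRing R
    (Quotient.mk (J ⊔ span {x}) v) (by rwa [Ne, Quotient.eq_zero_iff_mem])
  have key : ∀ a, a * v ∈ J ⊔ span {x} → a ∈ Q := by
    intro a ha
    apply hle
    rwa [Submodule.mem_colon_singleton, Submodule.mem_bot, Algebra.smul_def,
      Quotient.algebraMap_eq, ← map_mul, Quotient.eq_zero_iff_mem]
  refine ⟨Q, hQ, fun p hpP ↦ key p (le_sup_left (a := J) ((hN v).mp hv p hpP)), key x ?_⟩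
  exact mul_mem_right _ _ (le_sup_right (a := J) (mem_span_singleton_self x))

/-- The depth of a quotient is at most the dimension of each of its associated primes. -/
lemma DepthGE.le_ringKrullDim_quotient [IsNoetherianRing R] {r : ℕ} {J P : Ideal R}
    (h : DepthGE r J) (hP : P ∈ associatedPrimes R (R ⧸ J)) :
    (r : WithBot ℕ∞) ≤ ringKrullDim (R ⧸ P) := by
  induction r generalizing J P with
  | zero =>
    have := hP.isPrime
    simpa using ringKrullDim_nonneg_of_nontrivial (R := R ⧸ P)
  | succ r ih =>
    obtain ⟨x, hxm, hx, hd⟩ := h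
    obtain ⟨Q, hQ, hPQ, hxQ⟩ := exists_associatedPrimes_sup_span hxm hx hP
    have := hP.isPrime
    push_cast
    refine (add_le_add_left (ih hd hQ) 1).trans
      (ringKrullDim_succ_le_of_surjective (Quotient.factor hPQ) (Quotient.factor_surjective hPQ)
        (r := Quotient.mk P x) (mem_nonZeroDivisors_of_ne_zero ?_) ?_)
    · rw [Ne, Quotient.eq_zero_iff_mem]
      exact notMem_of_regularMod hx hP
    · rwa [Quotient.factor_mk, Quotient.eq_zero_iff_mem]

/-- Killing one more element of the maximal ideal drops the dimension by at most one. -/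
lemma ringKrullDim_quotient_le_sup_span_singleton [IsNoetherianRing R] {J : Ideal R} {x : R}
    (hx : x ∈ maximalIdeal R) :
    ringKrullDim (R ⧸ J) ≤ ringKrullDim (R ⧸ (J ⊔ span {x})) + 1 := by
  by_cases hJ : J = ⊤
  · have : Subsingleton (R ⧸ J) := Quotient.subsingleton_iff.mpr hJ
    rw [ringKrullDim_eq_bot_of_subsingleton]
    exact bot_le
  have : Nontrivial (R ⧸ J) := Quotient.nontrivial_iff.mpr hJ
  have : IsLocalRing (R ⧸ J) := .of_surjective' (Quotient.mk J) Quotient.mk_surjective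
  have : IsLocalHom (Quotient.mk J) := .of_surjective _ Quotient.mk_surjective
  have h := ringKrullDim_le_ringKrullDim_quotient_add_encard {Quotient.mk J x} (by
    rw [IsLocalRing.ringJacobson_eq_maximalIdeal, Set.singleton_subset_iff]
    exact map_nonunit (Quotient.mk J) x hx)
  have e : span {Quotient.mk J x} = (span {x}).map (Quotient.mk J) := by
    rw [map_span, Set.image_singleton]
  rw [e, ringKrullDim_eq_of_ringEquiv (DoubleQuot.quotQuotEquivQuotSup J (span {x}))] at h
  simpa using h

end Local
end Ideal

end LocalRing

namespace Ideal

lemma RegularMod.map_of_isLocalization {A B : Type*} [CommRing A] [CommRing B] [Algebra A B]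
    (M : Submonoid A) [IsLocalization M B] {J : Ideal A} {x : A} (hx : J.RegularMod x) :
    (J.map (algebraMap A B)).RegularMod (algebraMap A B x) := by
  intro b hb
  obtain ⟨a, s, rfl⟩ := IsLocalization.exists_mk'_eq M b
  rw [← IsLocalization.mk'_one (M := M) B x, ← IsLocalization.mk'_mul,
    IsLocalization.mk'_mem_map_algebraMap_iff] at hb
  obtain ⟨t, ht, h⟩ := hb
  rw [IsLocalization.mk'_mem_map_algebraMap_iff]
  exact ⟨t, ht, hx _ (by convert h using 1; ring)⟩

lemma ringKrullDim_quotient_map_le_of_isLocalization {A B : Type*} [CommRing A] [CommRing B]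
    [Algebra A B] (M : Submonoid A) [IsLocalization M B] (J : Ideal A) :
    ringKrullDim (B ⧸ J.map (algebraMap A B)) ≤ ringKrullDim (A ⧸ J) := by
  rw [ringKrullDim_quotient, ringKrullDim_quotient]
  refine Order.krullDim_le_of_strictMono (fun p ↦ ⟨PrimeSpectrum.comap (algebraMap A B) p.1, ?_⟩) ?_
  · exact (map_le_iff_le_comap.mp p.2 : J ≤ _)
  · intro p q hpq
    refine lt_of_le_of_ne (fun a ha ↦ hpq.le ha) fun h ↦ hpq.ne (Subtype.ext ?_)
    exact PrimeSpectrum.localization_comap_injective B M (congrArg Subtype.val h)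

end Ideal

namespace MvPolynomial

variable {σ K : Type*} [Field K]

/-- The irrelevant ideal, consisting of the polynomials with zero constant coefficient. -/
noncomputable abbrev irrelevantIdeal (σ K : Type*) [Field K] : Ideal (MvPolynomial σ K) :=
  RingHom.ker (constantCoeff (R := K) (σ := σ))

instance : (irrelevantIdeal σ K).IsPrime := RingHom.ker_isPrime _

lemma IsHomogeneous.mem_irrelevantIdeal_of_not_isUnit {f : MvPolynomial σ K} {d : ℕ}
    (hf : f.IsHomogeneous d) (hu : ¬ IsUnit f) : f ∈ irrelevantIdeal σ K := by
  rw [RingHom.mem_ker]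
  by_contra hc
  have hd : d = 0 := by
    by_contra hd
    exact hc (hf.coeff_eq_zero (by simpa using Ne.symm hd))
  subst hd
  rw [← totalDegree_zero_iff_isHomogeneous, totalDegree_eq_zero_iff_eq_C] at hf
  rw [constantCoeff_eq] at hc
  exact hu (hf ▸ (IsUnit.mk0 _ hc).map C)

lemma regularMod_span_X_image {s : Set σ} {j : σ} (hj : j ∉ s) :
    (Ideal.span ((X : σ → MvPolynomial σ K) '' s)).RegularMod (X j) := by
  intro a ha
  rw [mem_ideal_span_X_image] at ha ⊢
  intro v hv
  obtain ⟨i, hi, hne⟩ := ha (Finsupp.single j 1 + v) (by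
    rw [mem_support_iff, coeff_X_mul]
    exact mem_support_iff.mp hv)
  refine ⟨i, hi, fun h0 ↦ hne ?_⟩
  have : j ≠ i := fun h ↦ hj (h ▸ hi)
  simp [h0, this]

/-- The local ring of affine space at the origin has depth at least its dimension. -/
lemma depthGE_localization_irrelevantIdeal (n : ℕ) :
    Ideal.DepthGE n (⊥ : Ideal (Localization.AtPrime (irrelevantIdeal (Fin n) K))) := by
  let R := Localization.AtPrime (irrelevantIdeal (Fin n) K)
  let φ := algebraMap (MvPolynomial (Fin n) K) R
  suffices h : ∀ r j : ℕ, j + r = n → Ideal.DepthGE r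
      ((Ideal.span (X '' {i : Fin n | (i : ℕ) < j})).map φ) by
    simpa using h n 0 (zero_add n)
  have hX : ∀ i : Fin n, φ (X i) ∈ IsLocalRing.maximalIdeal R := fun i ↦
    (IsLocalization.AtPrime.to_map_mem_maximal_iff R (irrelevantIdeal (Fin n) K) _).mpr (by simp)
  intro r
  induction r with
  | zero =>
    intro j _
    refine Ideal.map_le_iff_le_comap.mpr (Ideal.span_le.mpr ?_)
    rintro _ ⟨i, -, rfl⟩
    exact hX i
  | succ r ih =>
    intro j hj
    let i : Fin n := ⟨j, by omega⟩
    refine ⟨φ (X i), hX i, Ideal.RegularMod.map_of_isLocalization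
      (irrelevantIdeal (Fin n) K).primeCompl (regularMod_span_X_image (by simp [i])), ?_⟩
    convert ih (j + 1) (by omega) using 1
    rw [← Set.image_singleton, ← Ideal.map_span, ← Ideal.map_sup, ← Ideal.span_union,
      ← Set.image_singleton, ← Set.image_union]
    congr 3
    ext l
    simp only [Set.union_singleton, Set.mem_insert_iff, Set.mem_ofPred_eq, Fin.ext_iff, i]
    omega

section Graded

attribute [local instance] MvPolynomial.gradedAlgebra

lemma _root_.Ideal.IsHomogeneous.mem_of_mul_mem {J : Ideal (MvPolynomial σ K)}
    (hJ : J.IsHomogeneous (homogeneousSubmodule σ K)) {s a : MvPolynomial σ K}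
    (hs : s ∉ irrelevantIdeal σ K) (h : s * a ∈ J) : a ∈ J := by
  have hdec (p : MvPolynomial σ K) (i : ℕ) :
      (DirectSum.decompose (homogeneousSubmodule σ K) p i : MvPolynomial σ K) =
        homogeneousComponent i p := decomposition.decompose'_apply p i
  have key : ∀ j, homogeneousComponent j a ∈ J := by
    intro j
    induction j using Nat.strong_induction_on with
    | _ j ih =>
      by_cases hj : j ∈ Finset.range (a.totalDegree + 1)
      · have hsum := homogeneousComponent_mem_of_mem hJ h j
        rw [← sum_homogeneousComponent a, Finset.mul_sum, map_sum,
          ← Finset.add_sum_erase _ _ hj] at hsum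
        have h0 : homogeneousComponent j (s * homogeneousComponent j a) =
            C (constantCoeff s) * homogeneousComponent j a := by
          have := DirectSum.coe_decompose_mul_of_right_mem_of_le (homogeneousSubmodule σ K) (a := s)
            (homogeneousComponent_mem j a) le_rfl
          rwa [Nat.sub_self, hdec, hdec, homogeneousComponent_zero, ← constantCoeff_eq] at this
        rw [h0, J.add_mem_iff_left (J.sum_mem fun i hi ↦ ?_)] at hsum
        · exact (J.unit_mul_mem_iff_mem ((IsUnit.mk0 _ hs).map C)).mp hsum
        · rcases lt_or_gt_of_ne (Finset.ne_of_mem_erase hi) with hlt | hgt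
          · exact homogeneousComponent_mem_of_mem hJ (J.mul_mem_left s (ih i hlt)) j
          · have := DirectSum.coe_decompose_mul_of_right_mem_of_not_le (homogeneousSubmodule σ K)
              (a := s) (homogeneousComponent_mem i a) hgt.not_ge
            rw [← hdec, this]
            exact J.zero_mem
      · rw [homogeneousComponent_eq_zero j a (by simpa using hj)]
        exact J.zero_mem
  rw [← sum_homogeneousComponent a]
  exact J.sum_mem fun i _ ↦ key i

end Graded

lemma exists_linear_forall_notMem [Infinite K] [Fintype σ]
    (T : Finset (Ideal (MvPolynomial σ K))) (hT : ∀ P ∈ T, ∃ j, X j ∉ P) :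
    ∃ l : MvPolynomial σ K, l.IsHomogeneous 1 ∧ ∀ P ∈ T, l ∉ P := by
  classical
  let L : (σ → K) →ₗ[K] MvPolynomial σ K := Fintype.linearCombination K X
  have hne := Subspace.biUnion_ne_univ_of_top_notMem
    (s := T.image fun P ↦ (P.restrictScalars K).comap L) (by
      simp only [Finset.mem_image, not_exists, not_and]
      intro P hP htop
      obtain ⟨j, hj⟩ := hT P hP
      refine hj ?_
      have : Pi.single j 1 ∈ (P.restrictScalars K).comap L := htop ▸ Submodule.mem_top
      simpa [L, Fintype.linearCombination_apply_single] using this)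
  obtain ⟨v, hv⟩ := (Set.ne_univ_iff_exists_notMem _).mp hne
  refine ⟨L v, ?_, fun P hP hl ↦ hv ?_⟩
  · rw [Fintype.linearCombination_apply]
    exact IsHomogeneous.sum _ _ _ fun i _ ↦ by
      rw [smul_eq_C_mul]
      simpa using (isHomogeneous_C σ (v i)).mul (isHomogeneous_X K i)
  · simp only [Finset.mem_image, Set.iUnion_exists, Set.biUnion_and', Set.iUnion_iUnion_eq_right,
      Set.mem_iUnion]
    exact ⟨P, hP, hl⟩

/-- Homogeneous prime avoidance for a pencil generated by two forms. -/
lemma exists_isHomogeneous_add_mul_notMem [Infinite K] [Fintype σ]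
    (T : Finset (Ideal (MvPolynomial σ K))) (hT : ∀ P ∈ T, P.IsPrime ∧ ∃ j, X j ∉ P)
    (a b : MvPolynomial σ K) (hab : ∀ P ∈ T, a ∈ P → b ∉ P) (e : ℕ) :
    ∃ h : MvPolynomial σ K, h.IsHomogeneous e ∧ ∀ P ∈ T, b + h * a ∉ P := by
  obtain ⟨l, hl, hlT⟩ := exists_linear_forall_notMem T fun P hP ↦ (hT P hP).2
  have hfin : (⋃ P ∈ T, {c : K | b + C c * l ^ e * a ∈ P}).Finite := by
    refine T.finite_toSet.biUnion fun P hP ↦ Set.Subsingleton.finite fun c hc c' hc' ↦ ?_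
    have hp := (hT P hP).1
    by_contra hne
    have haP : a ∈ P := by
      have h1 : C (c - c') * (l ^ e * a) ∈ P := by
        convert P.sub_mem hc hc' using 1
        rw [C_sub]
        ring
      rcases hp.mem_or_mem h1 with h2 | h2
      · exact absurd (Ideal.eq_top_of_isUnit_mem _ h2 ((IsUnit.mk0 _ (sub_ne_zero.mpr hne)).map C))
          hp.ne_top
      · exact (hp.mem_or_mem h2).resolve_left fun h3 ↦ hlT P hP (hp.mem_of_pow_mem _ h3)
    exact hab P hP haP ((P.add_mem_iff_left (P.mul_mem_left _ haP)).mp hc)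
  obtain ⟨c, hc⟩ := hfin.exists_notMem
  refine ⟨C c * l ^ e, ?_, fun P hP hmem ↦ hc (Set.mem_biUnion hP hmem)⟩
  simpa using (isHomogeneous_C σ c).mul (hl.pow e)

end MvPolynomial

namespace Ideal

lemma span_image_Iio_succ {R : Type*} [CommRing R] (F : ℕ → R) (i : ℕ) :
    span (F '' Set.Iio (i + 1)) = span (F '' Set.Iio i) ⊔ span {F i} := by
  rw [← Order.succ_eq_add_one, Order.Iio_succ_eq_insert, Set.image_insert_eq, span_insert, sup_comm]

lemma span_singleton_sup_span_image_add_mul {R : Type*} [CommRing R] (G h : ℕ → R) (i : ℕ) :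
    span {G 0} ⊔ span ((fun l ↦ G (l + 1) + h l * G 0) '' Set.Iio i) =
      span (G '' Set.Iio (i + 1)) := by
  induction i with
  | zero => rw [span_image_Iio_succ]; simp
  | succ i ih =>
    rw [span_image_Iio_succ G, ← ih, span_image_Iio_succ, ← sup_assoc, sup_right_comm,
      sup_right_comm (span {G 0}) _ (span {G (i + 1)})]
    congr 1
    rw [← span_insert, ← span_insert, span_pair_add_mul_left]

lemma ringKrullDim_quotient_span_image_Iio_le {R : Type*} [CommRing R] [IsNoetherianRing R]
    [IsLocalRing R] (G : ℕ → R) (hG : ∀ i, G i ∈ IsLocalRing.maximalIdeal R) (i c : ℕ) :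
    ringKrullDim (R ⧸ span (G '' Set.Iio i)) ≤
      ringKrullDim (R ⧸ span (G '' Set.Iio (i + c))) + (c : ℕ) := by
  induction c with
  | zero => simp
  | succ c ih =>
    refine ih.trans ?_
    rw [← add_assoc i, span_image_Iio_succ, Nat.cast_succ, add_comm (c : WithBot ℕ∞) 1,
      ← add_assoc]
    exact add_le_add_left (ringKrullDim_quotient_le_sup_span_singleton (hG _)) _

end Ideal

namespace MvPolynomial

variable {K : Type*} [Field K]

lemma exists_X_notMem_comap {n : ℕ} {P : Ideal (Localization.AtPrime (irrelevantIdeal (Fin n) K))}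
    (hP : P ≠ IsLocalRing.maximalIdeal _) [P.IsPrime] :
    ∃ j, X j ∉ P.comap (algebraMap (MvPolynomial (Fin n) K) _) := by
  by_contra! h
  refine hP (le_antisymm (IsLocalRing.le_maximalIdeal Ideal.IsPrime.ne_top') ?_)
  rw [← Localization.AtPrime.map_eq_maximalIdeal, Ideal.map_le_iff_le_comap]
  intro f hf
  rw [RingHom.mem_ker, constantCoeff_eq] at hf
  have : f ∈ Ideal.span (X '' (Set.univ : Set (Fin n))) := by
    rw [mem_ideal_span_X_image]
    intro v hv
    by_contra! h0
    have : v = 0 := Finsupp.ext fun i ↦ h0 i trivial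
    rw [mem_support_iff, this] at hv
    exact hv hf
  refine Ideal.span_le.mpr ?_ this
  rintro _ ⟨i, -, rfl⟩
  exact h i

/-- Over the local ring at the origin, a sequence whose quotient has dimension one more than
expected becomes regular after its later members are modified by multiples of its first one. -/
lemma exists_isHomogeneous_regularMod_localization [Infinite K] {N m k : ℕ} (hN : k + m + 1 = N)
    (G : ℕ → MvPolynomial (Fin N) K) (hG : ∀ i, G i ∈ irrelevantIdeal (Fin N) K)
    (hdim : ringKrullDim (MvPolynomial (Fin N) K ⧸ Ideal.span (G '' Set.Iio (m + 1))) ≤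
      (k + 1 : ℕ)) (e : ℕ → ℕ) :
    ∃ h : ℕ → MvPolynomial (Fin N) K, (∀ i, (h i).IsHomogeneous (e i)) ∧ ∀ i < m,
      ((Ideal.span ((fun l ↦ G (l + 1) + h l * G 0) '' Set.Iio i)).map
        (algebraMap _ (Localization.AtPrime (irrelevantIdeal (Fin N) K)))).RegularMod
          (algebraMap _ _ (G (i + 1) + h i * G 0)) := by
  classical
  let R := Localization.AtPrime (irrelevantIdeal (Fin N) K)
  let φ := algebraMap (MvPolynomial (Fin N) K) R
  have hmax (f : MvPolynomial (Fin N) K) (hf : f ∈ irrelevantIdeal (Fin N) K) :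
      φ f ∈ IsLocalRing.maximalIdeal R :=
    (IsLocalization.AtPrime.to_map_mem_maximal_iff R (irrelevantIdeal (Fin N) K) _).mpr
      (by simpa using hf)
  have hdimR (i : ℕ) (hi : i ≤ m) :
      ringKrullDim (R ⧸ (Ideal.span (G '' Set.Iio (i + 1))).map φ) ≤ (N - i : ℕ) := by
    have h1 := Ideal.ringKrullDim_quotient_span_image_Iio_le (fun l ↦ φ (G l))
      (fun l ↦ hmax _ (hG l)) (i + 1) (m - i)
    have h2 := (Ideal.ringKrullDim_quotient_map_le_of_isLocalization (B := R)
      (irrelevantIdeal (Fin N) K).primeCompl _).trans hdim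
    rw [show i + 1 + (m - i) = m + 1 by omega] at h1
    have him (s : Set ℕ) : (fun l ↦ φ (G l)) '' s = φ '' (G '' s) := (Set.image_image _ _ _).symm
    rw [him, him, ← Ideal.map_span, ← Ideal.map_span] at h1
    refine (h1.trans (add_le_add_left h2 _)).trans ?_
    rw [← Nat.cast_add]
    exact_mod_cast (show k + 1 + (m - i) ≤ N - i by omega)
  suffices H : ∀ j ≤ m, ∃ h : ℕ → MvPolynomial (Fin N) K, (∀ i, (h i).IsHomogeneous (e i)) ∧
      ∀ i < j, ((Ideal.span ((fun l ↦ G (l + 1) + h l * G 0) '' Set.Iio i)).map φ).RegularMod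
        (φ (G (i + 1) + h i * G 0)) from H m le_rfl
  intro j
  induction j with
  | zero => exact fun _ ↦ ⟨0, fun i ↦ isHomogeneous_zero _ _ _, by simp⟩
  | succ j ih =>
    intro hj
    obtain ⟨h, hh, hreg⟩ := ih (by omega)
    let F : ℕ → MvPolynomial (Fin N) K := fun l ↦ G (l + 1) + h l * G 0
    have hdepth : ∀ i ≤ j, ∀ r, i + r = N →
        Ideal.DepthGE r ((Ideal.span (F '' Set.Iio i)).map φ) := by
      intro i
      induction i with
      | zero =>
        intro _ r hr
        obtain rfl : r = N := by omega
        simpa using depthGE_localization_irrelevantIdeal (K := K) r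
      | succ i ih =>
        intro hi r hr
        rw [Ideal.span_image_Iio_succ, Ideal.map_sup, Ideal.map_span φ {_}, Set.image_singleton]
        exact (ih (by omega) (r + 1) (by omega)).sup_span_singleton
          (hmax _ (add_mem (hG _) (Ideal.mul_mem_left _ _ (hG _)))) (hreg i hi)
    have hle (P : Ideal R)
        (hP : P ∈ associatedPrimes R (R ⧸ (Ideal.span (F '' Set.Iio j)).map φ)) :=
      (hdepth j le_rfl (N - j) (by omega)).le_ringKrullDim_quotient hP
    have hfin := associatedPrimes.finite R (R ⧸ (Ideal.span (F '' Set.Iio j)).map φ)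
    obtain ⟨q, hq, hqT⟩ := exists_isHomogeneous_add_mul_notMem
      (hfin.toFinset.image (Ideal.comap φ)) (by
        simp only [Finset.mem_image, Set.Finite.mem_toFinset, forall_exists_index, and_imp]
        rintro _ P hP rfl
        have := hP.1
        refine ⟨Ideal.comap_isPrime _ _, exists_X_notMem_comap ?_⟩
        rintro rfl
        have h1 := hle _ hP
        rw [show ringKrullDim (R ⧸ IsLocalRing.maximalIdeal R) = 0 from
          ringKrullDim_eq_zero_of_field (IsLocalRing.ResidueField R)] at h1
        have : N - j ≤ 0 := by exact_mod_cast h1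
        omega) (G 0) (G (j + 1)) (by
        simp only [Finset.mem_image, Set.Finite.mem_toFinset, forall_exists_index, and_imp]
        rintro _ P hP rfl h0 h1
        have hKP : (Ideal.span (G '' Set.Iio (j + 1 + 1))).map φ ≤ P := by
          rw [Ideal.map_le_iff_le_comap, Ideal.span_image_Iio_succ,
            ← Ideal.span_singleton_sup_span_image_add_mul G h]
          refine sup_le (sup_le ?_ ?_) ?_
          · simpa using h0
          · rw [← Ideal.map_le_iff_le_comap]
            intro x hx
            obtain ⟨-, u, hu⟩ := Ideal.mem_associatedPrimes_quotient_iff.mp hP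
            exact (hu x).mpr (Ideal.mul_mem_right _ _ hx)
          · simpa using h1
        have h2 := ((hle P hP).trans (ringKrullDim_le_of_surjective _
          (Ideal.Quotient.factor_surjective hKP))).trans (hdimR (j + 1) hj)
        have : N - j ≤ N - (j + 1) := by exact_mod_cast h2
        omega) (e j)
    refine ⟨Function.update h j q, fun i ↦ ?_, fun i hi ↦ ?_⟩
    · rcases eq_or_ne i j with rfl | hij
      · simpa using hq
      · simpa [hij] using hh i
    · have himage : (fun l ↦ G (l + 1) + Function.update h j q l * G 0) '' Set.Iio i =
          F '' Set.Iio i := by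
        refine Set.image_congr fun l hl ↦ ?_
        have : l ≠ j := by
          have := Set.mem_Iio.mp hl
          omega
        simp [F, this]
      rw [himage]
      rcases eq_or_ne i j with rfl | hij
      · rw [Function.update_self]
        refine Ideal.regularMod_of_forall_notMem_associatedPrimes fun P hP hmem ↦ ?_
        exact hqT (P.comap φ) (Finset.mem_image_of_mem _ (hfin.mem_toFinset.mpr hP)) hmem
      · rw [Function.update_of_ne hij]
        exact hreg i (by omega)

section Graded

attribute [local instance] MvPolynomial.gradedAlgebra

lemma regularMod_of_regularMod_localization {σ : Type*} {J : Ideal (MvPolynomial σ K)}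
    (hJ : J.IsHomogeneous (homogeneousSubmodule σ K)) {f : MvPolynomial σ K}
    (h : (J.map (algebraMap _ (Localization.AtPrime (irrelevantIdeal σ K)))).RegularMod
      (algebraMap _ _ f)) : J.RegularMod f := by
  intro a ha
  have h1 := h (algebraMap _ _ a) (by rw [← map_mul]; exact Ideal.mem_map_of_mem _ ha)
  rw [IsLocalization.algebraMap_mem_map_algebraMap_iff (irrelevantIdeal σ K).primeCompl] at h1
  obtain ⟨s, hs, hsa⟩ := h1
  exact hJ.mem_of_mul_mem hs hsa

/-- Sequences of forms modified by multiples of the first one are regular for a suitable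
choice of the multipliers. -/
lemma exists_isHomogeneous_regularMod [Infinite K] {N m k : ℕ} (hN : k + m + 1 = N)
    (G : ℕ → MvPolynomial (Fin N) K) (D : ℕ → ℕ) (hGD : ∀ i, (G i).IsHomogeneous (D i))
    (hD : ∀ i < m, D 0 ≤ D (i + 1))
    (hG : ∀ i, G i ∈ irrelevantIdeal (Fin N) K)
    (hdim : ringKrullDim (MvPolynomial (Fin N) K ⧸ Ideal.span (G '' Set.Iio (m + 1))) ≤
      (k + 1 : ℕ)) :
    ∃ h : ℕ → MvPolynomial (Fin N) K, ∀ i < m,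
      (G (i + 1) + h i * G 0).IsHomogeneous (D (i + 1)) ∧
      (Ideal.span ((fun l ↦ G (l + 1) + h l * G 0) '' Set.Iio i)).RegularMod
          (G (i + 1) + h i * G 0) := by
  obtain ⟨h, hh, hreg⟩ := exists_isHomogeneous_regularMod_localization hN G hG hdim
    fun i ↦ D (i + 1) - D 0
  have hhom (i : ℕ) (hi : i < m) : (G (i + 1) + h i * G 0).IsHomogeneous (D (i + 1)) := by
    refine (hGD _).add ?_
    have := (hh i).mul (hGD 0)
    rwa [Nat.sub_add_cancel (hD i hi)] at this
  refine ⟨h, fun i hi ↦ ⟨hhom i hi, regularMod_of_regularMod_localization ?_ (hreg i hi)⟩⟩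
  refine Ideal.homogeneous_span _ _ ?_
  rintro _ ⟨l, hl, rfl⟩
  exact ⟨D (l + 1), hhom l (lt_trans hl hi)⟩

end Graded

end MvPolynomial

lemma Ideal.isRegular_ofFn {R : Type*} [CommRing R] {m : ℕ} (F : ℕ → R)
    (hreg : ∀ i < m, (span (F '' Set.Iio i)).RegularMod (F i))
    (hne : span (F '' Set.Iio m) ≠ ⊤) :
    RingTheory.Sequence.IsRegular R (List.ofFn fun i : Fin m ↦ F i) := by
  have hlist (i : ℕ) (hi : i ≤ m) :
      Ideal.ofList ((List.ofFn fun i : Fin m ↦ F i).take i) = span (F '' Set.Iio i) := by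
    rw [Ideal.ofList]
    congr 1
    ext x
    simp only [List.mem_take_iff_getElem, List.length_ofFn, List.getElem_ofFn, Set.mem_image,
      Set.mem_Iio]
    constructor
    · rintro ⟨l, hl, rfl⟩
      exact ⟨l, by omega, rfl⟩
    · rintro ⟨l, hl, rfl⟩
      exact ⟨l, by omega, rfl⟩
  refine ⟨⟨fun i hi ↦ ?_⟩, ?_⟩
  · rw [List.length_ofFn] at hi
    rw [hlist i hi.le, List.getElem_ofFn, isSMulRegular_iff_right_eq_zero_of_smul]
    intro y hy
    obtain ⟨a, rfl⟩ := Submodule.Quotient.mk_surjective _ y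
    rw [← Submodule.Quotient.mk_smul, Submodule.Quotient.mk_eq_zero] at hy
    rw [Submodule.Quotient.mk_eq_zero]
    simp only [smul_eq_mul, Ideal.mul_top] at hy ⊢
    exact hreg i hi a hy
  · have := hlist m le_rfl
    rw [List.take_of_length_le (by simp)] at this
    rw [this, smul_eq_mul, Ideal.mul_top]
    exact hne.symm

/-- Let `I = (f_k, …, f_n) ⊂ S = K[x₀,…,xₙ]` be a proper homogeneous
ideal with `dim Proj (S/I) = k` (a quasi-complete intersection); here `g i = f_{k+i}`,
`m = n - k`.  Then the generators of index `> k` may be replaced by homogeneous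
polynomials of the same degrees forming a regular sequence. -/
theorem stmt7 (K : Type) [Field K] [IsAlgClosed K] (n k m : ℕ)
    (hm : 0 < m) (hkm : k + m = n)
    (d : Fin (m + 1) → ℕ) (hd : Monotone d)
    (g : Fin (m + 1) → MvPolynomial (Fin (n + 1)) K)
    (hhom : ∀ i, (g i).IsHomogeneous (d i))
    (hproper : Ideal.span (Set.range g) ≠ ⊤)
    (hdim : ringKrullDim (MvPolynomial (Fin (n + 1)) K ⧸ Ideal.span (Set.range g)) =
      (k + 1 : ℕ)) :
    ∃ g' : Fin m → MvPolynomial (Fin (n + 1)) K,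
      (∀ i : Fin m, (g' i).IsHomogeneous (d i.succ)) ∧
      Ideal.span ({g 0} ∪ Set.range g') = Ideal.span (Set.range g) ∧
      RingTheory.Sequence.IsRegular (MvPolynomial (Fin (n + 1)) K) (List.ofFn g') := by
  let G : ℕ → MvPolynomial (Fin (n + 1)) K := fun i ↦ if h : i < m + 1 then g ⟨i, h⟩ else 0
  let D : ℕ → ℕ := fun i ↦ if h : i < m + 1 then d ⟨i, h⟩ else 0
  have hGg (i : Fin (m + 1)) : G i = g i := dif_pos i.2
  have hDd (i : Fin (m + 1)) : D i = d i := dif_pos i.2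
  have hrange : G '' Set.Iio (m + 1) = Set.range g := by
    ext x
    constructor
    · rintro ⟨i, hi, rfl⟩
      exact ⟨⟨i, hi⟩, (hGg ⟨i, hi⟩).symm⟩
    · rintro ⟨i, rfl⟩
      exact ⟨i, i.2, hGg i⟩
  have hGD (i : ℕ) : (G i).IsHomogeneous (D i) := by
    by_cases hi : i < m + 1
    · simpa only [G, D, dif_pos hi] using hhom ⟨i, hi⟩
    · simpa only [G, D, dif_neg hi] using MvPolynomial.isHomogeneous_zero _ _ _
  have hG (i : ℕ) : G i ∈ MvPolynomial.irrelevantIdeal (Fin (n + 1)) K := by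
    by_cases hi : i < m + 1
    · refine (hGD i).mem_irrelevantIdeal_of_not_isUnit fun hu ↦ hproper ?_
      refine Ideal.eq_top_of_isUnit_mem _ (Ideal.subset_span ?_) hu
      exact ⟨⟨i, hi⟩, (hGg ⟨i, hi⟩).symm⟩
    · simp only [G, dif_neg hi, zero_mem]
  obtain ⟨h, hh⟩ := MvPolynomial.exists_isHomogeneous_regularMod (m := m) (k := k) (by omega) G D
    hGD (fun i hi ↦ (hDd 0).trans_le ((hd (Fin.zero_le _)).trans_eq (hDd ⟨i + 1, by omega⟩).symm))
    hG (by rw [hrange, hdim])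
  have hspan := Ideal.span_singleton_sup_span_image_add_mul G h m
  rw [hrange] at hspan
  have hF : Set.range (fun i : Fin m ↦ G (i + 1) + h i * G 0) =
      (fun l ↦ G (l + 1) + h l * G 0) '' Set.Iio m := by
    rw [← Fin.range_val, ← Set.range_comp]
    rfl
  refine ⟨fun i ↦ G (i + 1) + h i * G 0, fun i ↦ ?_, ?_, ?_⟩
  · exact hDd i.succ ▸ (hh i i.2).1
  · rw [hF, Ideal.span_union, ← hspan]
    rfl
  · refine Ideal.isRegular_ofFn (fun l ↦ G (l + 1) + h l * G 0) (fun i hi ↦ (hh i hi).2) ?_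
    exact ne_top_of_le_ne_top hproper (hspan ▸ le_sup_right)
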